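/- For every t ∈ [0,T], the optimal value satisfies v* = ⨆_{x ∈ X} (v→(x,t) + v←(x,t)), the supremum being taken in the extended reals. -/

import Mathlib

open MeasureTheory Set

noncomputable section

/-- An admissible pair `(y,u)` on the time interval `[t₀,t₁]`: the control `u` is
measurable with values in `U`, the trajectory `y` stays in `X`, and `y` is absolutely
continuous with `y'(s) = f (y s) (u s)` for a.e. `s ∈ [t₀,t₁]` (expressed by the
integral representation). -/
def IsAdmissible {d m : ℕ} (X : Set (EuclideanSpace ℝ (Fin d)))
    (U : Set (EuclideanSpace ℝ (Fin m)))
    (f : EuclideanSpace ℝ (Fin d) → EuclideanSpace ℝ (Fin m) → EuclideanSpace ℝ (Fin d))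
    (t₀ t₁ : ℝ) (y : ℝ → EuclideanSpace ℝ (Fin d))
    (u : ℝ → EuclideanSpace ℝ (Fin m)) : Prop :=
  Measurable u ∧ (∀ s ∈ Icc t₀ t₁, u s ∈ U) ∧ (∀ s ∈ Icc t₀ t₁, y s ∈ X) ∧
    ∀ t ∈ Icc t₀ t₁, y t = y t₀ + ∫ s in t₀..t, f (y s) (u s)

/-- The optimal value `v*` of the finite-horizon problem, as an extended real. -/
def vStar {d m : ℕ} (X : Set (EuclideanSpace ℝ (Fin d)))
    (U : Set (EuclideanSpace ℝ (Fin m)))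
    (f : EuclideanSpace ℝ (Fin d) → EuclideanSpace ℝ (Fin m) → EuclideanSpace ℝ (Fin d))
    (ℓ : EuclideanSpace ℝ (Fin d) → EuclideanSpace ℝ (Fin m) → ℝ)
    (φ₀ φT : EuclideanSpace ℝ (Fin d) → ℝ) (T : ℝ) : EReal :=
  ⨆ (p : (ℝ → EuclideanSpace ℝ (Fin d)) × (ℝ → EuclideanSpace ℝ (Fin m)))
    (_ : IsAdmissible X U f 0 T p.1 p.2),
      (((∫ s in (0:ℝ)..T, ℓ (p.1 s) (p.2 s)) + φ₀ (p.1 0) + φT (p.1 T) : ℝ) : EReal)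

/-- The backward value function `v←(x,t)`. -/
def vBack {d m : ℕ} (X : Set (EuclideanSpace ℝ (Fin d)))
    (U : Set (EuclideanSpace ℝ (Fin m)))
    (f : EuclideanSpace ℝ (Fin d) → EuclideanSpace ℝ (Fin m) → EuclideanSpace ℝ (Fin d))
    (ℓ : EuclideanSpace ℝ (Fin d) → EuclideanSpace ℝ (Fin m) → ℝ)
    (φT : EuclideanSpace ℝ (Fin d) → ℝ) (T : ℝ)
    (x : EuclideanSpace ℝ (Fin d)) (t : ℝ) : EReal :=
  ⨆ (p : (ℝ → EuclideanSpace ℝ (Fin d)) × (ℝ → EuclideanSpace ℝ (Fin m)))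
    (_ : IsAdmissible X U f t T p.1 p.2 ∧ p.1 t = x),
      (((∫ s in t..T, ℓ (p.1 s) (p.2 s)) + φT (p.1 T) : ℝ) : EReal)

/-- The forward value function `v→(x,t)`. -/
def vFor {d m : ℕ} (X : Set (EuclideanSpace ℝ (Fin d)))
    (U : Set (EuclideanSpace ℝ (Fin m)))
    (f : EuclideanSpace ℝ (Fin d) → EuclideanSpace ℝ (Fin m) → EuclideanSpace ℝ (Fin d))
    (ℓ : EuclideanSpace ℝ (Fin d) → EuclideanSpace ℝ (Fin m) → ℝ)
    (φ₀ : EuclideanSpace ℝ (Fin d) → ℝ)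
    (x : EuclideanSpace ℝ (Fin d)) (t : ℝ) : EReal :=
  ⨆ (p : (ℝ → EuclideanSpace ℝ (Fin d)) × (ℝ → EuclideanSpace ℝ (Fin m)))
    (_ : IsAdmissible X U f 0 t p.1 p.2 ∧ p.1 t = x),
      (((∫ s in (0:ℝ)..t, ℓ (p.1 s) (p.2 s)) + φ₀ (p.1 0) : ℝ) : EReal)

section DynamicProgramming

variable {d m : ℕ} {X : Set (EuclideanSpace ℝ (Fin d))} {U : Set (EuclideanSpace ℝ (Fin m))}
  {f : EuclideanSpace ℝ (Fin d) → EuclideanSpace ℝ (Fin m) → EuclideanSpace ℝ (Fin d)}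
  {t₀ t₁ t₂ : ℝ} {y y₁ y₂ : ℝ → EuclideanSpace ℝ (Fin d)}
  {u u₁ u₂ : ℝ → EuclideanSpace ℝ (Fin m)}

/-- A jointly continuous bounded function of a measurable trajectory and control is integrable. -/
theorem intervalIntegrable_comp_of_bounded {E : Type*} [NormedAddCommGroup E]
    [SecondCountableTopology E]
    {g : EuclideanSpace ℝ (Fin d) → EuclideanSpace ℝ (Fin m) → E}
    (hgc : Continuous fun p : EuclideanSpace ℝ (Fin d) × EuclideanSpace ℝ (Fin m) => g p.1 p.2)
    (hgb : ∃ C, ∀ x v, ‖g x v‖ ≤ C) (h01 : t₀ ≤ t₁) (hu : Measurable u)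
    (hy : AEStronglyMeasurable y (volume.restrict (Icc t₀ t₁))) :
    IntervalIntegrable (fun s => g (y s) (u s)) volume t₀ t₁ := by
  obtain ⟨C, hC⟩ := hgb
  rw [intervalIntegrable_iff_integrableOn_Icc_of_le h01]
  exact Integrable.of_bound
    (hgc.comp_aestronglyMeasurable (hy.prodMk hu.aestronglyMeasurable)) C
    (Filter.Eventually.of_forall fun s => hC _ _)

/-- The integral representation forces measurability of the trajectory: it holds where the
integrand is integrable, and beyond that the integral vanishes, so the trajectory is constant. -/
theorem aestronglyMeasurable_of_eq_add_integral {E : Type*} [NormedAddCommGroup E]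
    [NormedSpace ℝ E] [SecondCountableTopology E] {z g : ℝ → E}
    (hz : ∀ t ∈ Icc t₀ t₁, z t = z t₀ + ∫ s in t₀..t, g s) :
    AEStronglyMeasurable z (volume.restrict (Icc t₀ t₁)) := by
  set S : Set ℝ := {t ∈ Icc t₀ t₁ | IntervalIntegrable g volume t₀ t}
  have hdown : ∀ t ∈ S, Icc t₀ t ⊆ S := fun t ht s hs =>
    ⟨⟨hs.1, hs.2.trans ht.1.2⟩, ht.2.mono_set (by
      rw [uIcc_of_le hs.1, uIcc_of_le ht.1.1]; exact Icc_subset_Icc_right hs.2)⟩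
  have hmeas : MeasurableSet S := by
    refine OrdConnected.measurableSet ⟨fun a ha b hb s hs => ?_⟩
    exact hdown b hb ⟨ha.1.1.trans hs.1, hs.2⟩
  have hcontIcc : ∀ t ∈ S, ContinuousOn z (Icc t₀ t) := fun t ht => by
    have h := intervalIntegral.continuousOn_primitive_interval' ht.2 left_mem_uIcc
    rw [uIcc_of_le ht.1.1] at h
    exact (continuousOn_const.add h).congr fun s hs => hz s (hdown t ht hs).1
  have hcont : ContinuousOn z S := by
    intro x hx
    by_cases hmax : ∃ t ∈ S, x < t
    · obtain ⟨t, ht, hxt⟩ := hmax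
      refine (hcontIcc t ht x ⟨hx.1.1, hxt.le⟩).mono_of_mem_nhdsWithin ?_
      filter_upwards [self_mem_nhdsWithin, mem_nhdsWithin_of_mem_nhds (Iio_mem_nhds hxt)]
        with s hs hst using ⟨hs.1.1, le_of_lt hst⟩
    · push Not at hmax
      exact (hcontIcc x hx x ⟨hx.1.1, le_rfl⟩).mono fun s hs => ⟨hs.1.1, hmax s hs⟩
  have hdiff : AEStronglyMeasurable z (volume.restrict (Icc t₀ t₁ \ S)) := by
    refine (aestronglyMeasurable_const (b := z t₀)).congr ?_
    filter_upwards [ae_restrict_mem (measurableSet_Icc.diff hmeas)] with s hs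
    rw [hz s hs.1, intervalIntegral.integral_undef fun h => hs.2 ⟨hs.1, h⟩, add_zero]
  rw [← union_sdiff_cancel (show S ⊆ Icc t₀ t₁ from fun s hs => hs.1)]
  exact aestronglyMeasurable_union_iff.2 ⟨hcont.aestronglyMeasurable hmeas, hdiff⟩

theorem IsAdmissible.aestronglyMeasurable (h : IsAdmissible X U f t₀ t₁ y u) :
    AEStronglyMeasurable y (volume.restrict (Icc t₀ t₁)) :=
  aestronglyMeasurable_of_eq_add_integral h.2.2.2

theorem IsAdmissible.intervalIntegrable {E : Type*} [NormedAddCommGroup E]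
    [SecondCountableTopology E]
    {g : EuclideanSpace ℝ (Fin d) → EuclideanSpace ℝ (Fin m) → E}
    (h : IsAdmissible X U f t₀ t₁ y u)
    (hgc : Continuous fun p : EuclideanSpace ℝ (Fin d) × EuclideanSpace ℝ (Fin m) => g p.1 p.2)
    (hgb : ∃ C, ∀ x v, ‖g x v‖ ≤ C) (h01 : t₀ ≤ t₁) :
    IntervalIntegrable (fun s => g (y s) (u s)) volume t₀ t₁ :=
  intervalIntegrable_comp_of_bounded hgc hgb h01 h.1 h.aestronglyMeasurable

theorem IsAdmissible.restrict_left (h : IsAdmissible X U f t₀ t₂ y u) (h12 : t₁ ≤ t₂) :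
    IsAdmissible X U f t₀ t₁ y u :=
  have hsub : Icc t₀ t₁ ⊆ Icc t₀ t₂ := Icc_subset_Icc_right h12
  ⟨h.1, fun s hs => h.2.1 s (hsub hs), fun s hs => h.2.2.1 s (hsub hs),
    fun s hs => h.2.2.2 s (hsub hs)⟩

theorem IsAdmissible.restrict_right (h : IsAdmissible X U f t₀ t₂ y u)
    (hfc : Continuous fun p : EuclideanSpace ℝ (Fin d) × EuclideanSpace ℝ (Fin m) => f p.1 p.2)
    (hfb : ∃ C, ∀ x v, ‖f x v‖ ≤ C) (h01 : t₀ ≤ t₁) (h12 : t₁ ≤ t₂) :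
    IsAdmissible X U f t₁ t₂ y u := by
  have hsub : Icc t₁ t₂ ⊆ Icc t₀ t₂ := Icc_subset_Icc_left h01
  refine ⟨h.1, fun s hs => h.2.1 s (hsub hs), fun s hs => h.2.2.1 s (hsub hs), fun s hs => ?_⟩
  have hint₁ := (h.restrict_left h12).intervalIntegrable hfc hfb h01
  have hint := (h.restrict_left hs.2).intervalIntegrable hfc hfb (hsub hs).1
  rw [h.2.2.2 s (hsub hs), h.2.2.2 t₁ ⟨h01, h12⟩, add_assoc,
    intervalIntegral.integral_add_adjacent_intervals hint₁ (hint₁.symm.trans hint)]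

/-- Concatenation at time `t` of two functions of time. -/
def concatAt {α : Type*} (t : ℝ) (a b : ℝ → α) (s : ℝ) : α := if s ≤ t then a s else b s

theorem integral_concatAt_left {E : Type*} [NormedAddCommGroup E] [NormedSpace ℝ E]
    (g : EuclideanSpace ℝ (Fin d) → EuclideanSpace ℝ (Fin m) → E) (h01 : t₀ ≤ t₁) (h12 : t₁ ≤ t₂) :
    ∫ s in t₀..t₁, g (concatAt t₂ y₁ y₂ s) (concatAt t₂ u₁ u₂ s) =
      ∫ s in t₀..t₁, g (y₁ s) (u₁ s) := by
  refine intervalIntegral.integral_congr fun s hs => ?_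
  rw [uIcc_of_le h01] at hs
  simp [concatAt, hs.2.trans h12]

theorem integral_concatAt_right {E : Type*} [NormedAddCommGroup E] [NormedSpace ℝ E]
    (g : EuclideanSpace ℝ (Fin d) → EuclideanSpace ℝ (Fin m) → E) (h01 : t₀ ≤ t₁) :
    ∫ s in t₀..t₁, g (concatAt t₀ y₁ y₂ s) (concatAt t₀ u₁ u₂ s) =
      ∫ s in t₀..t₁, g (y₂ s) (u₂ s) := by
  refine intervalIntegral.integral_congr_ae (Filter.Eventually.of_forall fun s hs => ?_)
  rw [uIoc_of_le h01] at hs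
  simp [concatAt, not_le.2 hs.1]

theorem concatAt_eq_right {α : Type*} {a b : ℝ → α} {t s : ℝ} (hab : a t = b t) (hs : t ≤ s) :
    concatAt t a b s = b s := by
  rcases hs.eq_or_lt with rfl | hlt
  · simp [concatAt, hab]
  · simp [concatAt, not_le.2 hlt]

theorem aestronglyMeasurable_concatAt {E : Type*} [TopologicalSpace E]
    [TopologicalSpace.PseudoMetrizableSpace E] {a b : ℝ → E}
    (ha : AEStronglyMeasurable a (volume.restrict (Icc t₀ t₁)))
    (hb : AEStronglyMeasurable b (volume.restrict (Icc t₁ t₂))) (h01 : t₀ ≤ t₁) (h12 : t₁ ≤ t₂) :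
    AEStronglyMeasurable (concatAt t₁ a b) (volume.restrict (Icc t₀ t₂)) := by
  rw [← Icc_union_Ioc_eq_Icc h01 h12]
  refine aestronglyMeasurable_union_iff.2 ⟨ha.congr ?_,
    (hb.mono_measure (Measure.restrict_mono_set _ Ioc_subset_Icc_self)).congr ?_⟩
  · filter_upwards [ae_restrict_mem measurableSet_Icc] with s hs
    simp [concatAt, hs.2]
  · filter_upwards [ae_restrict_mem measurableSet_Ioc] with s hs
    simp [concatAt, not_le.2 hs.1]

theorem measurable_concatAt {α : Type*} [MeasurableSpace α] {a b : ℝ → α} {t : ℝ}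
    (ha : Measurable a) (hb : Measurable b) : Measurable (concatAt t a b) :=
  Measurable.ite measurableSet_Iic ha hb

theorem integral_concatAt {E : Type*} [NormedAddCommGroup E] [NormedSpace ℝ E]
    [SecondCountableTopology E]
    {g : EuclideanSpace ℝ (Fin d) → EuclideanSpace ℝ (Fin m) → E}
    (h₁ : IsAdmissible X U f t₀ t₁ y₁ u₁) (h₂ : IsAdmissible X U f t₁ t₂ y₂ u₂)
    (hgc : Continuous fun p : EuclideanSpace ℝ (Fin d) × EuclideanSpace ℝ (Fin m) => g p.1 p.2)
    (hgb : ∃ C, ∀ x v, ‖g x v‖ ≤ C) (h01 : t₀ ≤ t₁) (h12 : t₁ ≤ t₂) :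
    ∫ s in t₀..t₂, g (concatAt t₁ y₁ y₂ s) (concatAt t₁ u₁ u₂ s) =
      (∫ s in t₀..t₁, g (y₁ s) (u₁ s)) + ∫ s in t₁..t₂, g (y₂ s) (u₂ s) := by
  have hint := intervalIntegrable_comp_of_bounded hgc hgb (h01.trans h12)
    (measurable_concatAt (t := t₁) h₁.1 h₂.1)
    (aestronglyMeasurable_concatAt h₁.aestronglyMeasurable h₂.aestronglyMeasurable h01 h12)
  have hmem : t₁ ∈ uIcc t₀ t₂ := mem_uIcc_of_le h01 h12
  rw [← intervalIntegral.integral_add_adjacent_intervals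
    (hint.mono_set (uIcc_subset_uIcc_left hmem)) (hint.mono_set (uIcc_subset_uIcc_right hmem)),
    integral_concatAt_left g h01 le_rfl, integral_concatAt_right g h12]

theorem IsAdmissible.concat (h₁ : IsAdmissible X U f t₀ t₁ y₁ u₁)
    (h₂ : IsAdmissible X U f t₁ t₂ y₂ u₂)
    (hfc : Continuous fun p : EuclideanSpace ℝ (Fin d) × EuclideanSpace ℝ (Fin m) => f p.1 p.2)
    (hfb : ∃ C, ∀ x v, ‖f x v‖ ≤ C) (h01 : t₀ ≤ t₁) (hy : y₁ t₁ = y₂ t₁) :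
    IsAdmissible X U f t₀ t₂ (concatAt t₁ y₁ y₂) (concatAt t₁ u₁ u₂) := by
  refine ⟨measurable_concatAt h₁.1 h₂.1, fun s hs => ?_, fun s hs => ?_, fun s hs => ?_⟩
  · by_cases hst : s ≤ t₁
    · simpa [concatAt, hst] using h₁.2.1 s ⟨hs.1, hst⟩
    · simpa [concatAt, hst] using h₂.2.1 s ⟨(not_le.1 hst).le, hs.2⟩
  · by_cases hst : s ≤ t₁
    · simpa [concatAt, hst] using h₁.2.2.1 s ⟨hs.1, hst⟩
    · simpa [concatAt, hst] using h₂.2.2.1 s ⟨(not_le.1 hst).le, hs.2⟩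
  · have h0 : concatAt t₁ y₁ y₂ t₀ = y₁ t₀ := if_pos h01
    rw [h0]
    by_cases hst : s ≤ t₁
    · rw [integral_concatAt_left f hs.1 hst, ← h₁.2.2.2 s ⟨hs.1, hst⟩]
      exact if_pos hst
    · have hts : t₁ ≤ s := (not_le.1 hst).le
      rw [integral_concatAt h₁ (h₂.restrict_left hs.2) hfc hfb h01 hts, ← add_assoc,
        ← h₁.2.2.2 t₁ ⟨h01, le_rfl⟩, hy, ← h₂.2.2.2 s ⟨hts, hs.2⟩]
      exact if_neg hst

end DynamicProgramming

/-- Proposition 2.2, equation (11): for every `t ∈ [0,T]`,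
`v* = ⨆ x ∈ X, (v→(x,t) + v←(x,t))` in the extended reals. -/
theorem value_eq_sup_forward_add_backward {d m : ℕ}
    (T : ℝ) (hT : 0 < T)
    (X : Set (EuclideanSpace ℝ (Fin d))) (hX : Bornology.IsBounded X)
    (U : Set (EuclideanSpace ℝ (Fin m)))
    (ℓ : EuclideanSpace ℝ (Fin d) → EuclideanSpace ℝ (Fin m) → ℝ)
    (hℓc : Continuous fun p : EuclideanSpace ℝ (Fin d) × EuclideanSpace ℝ (Fin m) => ℓ p.1 p.2)
    (hℓb : ∃ C, ∀ x u, |ℓ x u| ≤ C)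
    (f : EuclideanSpace ℝ (Fin d) → EuclideanSpace ℝ (Fin m) → EuclideanSpace ℝ (Fin d))
    (hfc : Continuous fun p : EuclideanSpace ℝ (Fin d) × EuclideanSpace ℝ (Fin m) => f p.1 p.2)
    (hfb : ∃ C, ∀ x u, ‖f x u‖ ≤ C)
    (φ₀ φT : EuclideanSpace ℝ (Fin d) → ℝ)
    (hφ₀c : Continuous φ₀) (hφ₀b : ∃ C, ∀ x, |φ₀ x| ≤ C)
    (hφTc : Continuous φT) (hφTb : ∃ C, ∀ x, |φT x| ≤ C)
    (t : ℝ) (ht : t ∈ Icc 0 T) :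
    vStar X U f ℓ φ₀ φT T =
      ⨆ x ∈ X, (vFor X U f ℓ φ₀ x t + vBack X U f ℓ φT T x t) := by
  have hℓb' : ∃ C, ∀ x v, ‖ℓ x v‖ ≤ C := hℓb
  obtain ⟨ht0, htT⟩ := ht
  apply le_antisymm
  · refine iSup₂_le fun ⟨y, u⟩ h => ?_
    dsimp only at h ⊢
    have h₁ := h.restrict_left htT
    have h₂ := h.restrict_right hfc hfb ht0 htT
    refine le_trans (le_of_eq ?_) (le_trans (add_le_add
      (le_iSup₂_of_le (y, u) ⟨h₁, rfl⟩ le_rfl) (le_iSup₂_of_le (y, u) ⟨h₂, rfl⟩ le_rfl))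
      (le_iSup₂_of_le (y t) (h.2.2.1 t ⟨ht0, htT⟩) le_rfl))
    rw [← EReal.coe_add, ← intervalIntegral.integral_add_adjacent_intervals
      (h₁.intervalIntegrable hℓc hℓb' ht0) (h₂.intervalIntegrable hℓc hℓb' htT)]
    congr 1
    ring
  · refine iSup₂_le fun x _ => EReal.add_le_of_forall_lt fun a ha b hb => ?_
    simp only [vFor, vBack, lt_iSup_iff] at ha hb
    obtain ⟨⟨y₁, u₁⟩, ⟨h₁, hx₁⟩, ha⟩ := ha
    obtain ⟨⟨y₂, u₂⟩, ⟨h₂, hx₂⟩, hb⟩ := hb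
    dsimp only at h₁ h₂ hx₁ hx₂ ha hb
    have hy : y₁ t = y₂ t := hx₁.trans hx₂.symm
    refine (add_le_add ha.le hb.le).trans
      (le_iSup₂_of_le (concatAt t y₁ y₂, concatAt t u₁ u₂)
        (h₁.concat h₂ hfc hfb ht0 hy) (le_of_eq ?_))
    dsimp only
    rw [← EReal.coe_add, integral_concatAt h₁ h₂ hℓc hℓb' ht0 htT, concatAt_eq_right hy htT,
      show concatAt t y₁ y₂ 0 = y₁ 0 from if_pos ht0]
    congr 1
    ring
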